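/- arXiv:2012.08944 — 2 statements merged into one kernel-verified Lean document; each statement's English description precedes it below -/
import Mathlib

section
/- For all real z and α: Σ_{k=0}^∞ (-1)^k J_{6k+3}(z)·cos((6k+3)α) = −(1/6)·Σ_{ℓ=0}^{2} sin(z·cos(α + 2πℓ/3)). -/
open scoped Real

/-- Bessel function of the first kind of integer order `m`,
defined by `J_m(z) = (1/2π) ∫_0^{2π} e^{i z sin θ - i m θ} dθ`. -/
noncomputable def besselJ (m : ℤ) (z : ℂ) : ℂ :=
  (1 / (2 * Real.pi)) * ∫ θ in (0:ℝ)..(2 * Real.pi),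
    Complex.exp (z * Complex.sin (θ:ℂ) * Complex.I - (m:ℂ) * (θ:ℂ) * Complex.I)

theorem continuous_besselJ_integrand (m : ℤ) (z : ℂ) :
    Continuous fun θ : ℝ =>
      Complex.exp (z * Complex.sin (θ:ℂ) * Complex.I - (m:ℂ) * (θ:ℂ) * Complex.I) := by
  fun_prop

theorem norm_besselJ_le_one (m : ℤ) (z : ℝ) : ‖besselJ m z‖ ≤ 1 := by
  have h : ‖∫ θ in (0:ℝ)..(2 * Real.pi),
      Complex.exp (z * Complex.sin (θ:ℂ) * Complex.I - (m:ℂ) * (θ:ℂ) * Complex.I)‖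
      ≤ 1 * |2 * Real.pi - 0| := by
    apply intervalIntegral.norm_integral_le_of_norm_le_const
    intro θ _
    have : (z * Complex.sin (θ:ℂ) * Complex.I - (m:ℂ) * (θ:ℂ) * Complex.I)
        = ((z * Real.sin θ - m * θ : ℝ) : ℂ) * Complex.I := by
      push_cast; ring
    rw [this, Complex.norm_exp_ofReal_mul_I]
  rw [sub_zero, abs_of_pos Real.two_pi_pos, one_mul] at h
  have h2 : ‖(1 / (2 * Real.pi) : ℂ)‖ = 1 / (2 * Real.pi) := by
    rw [show (1 / (2 * Real.pi) : ℂ) = ((1 / (2 * Real.pi) : ℝ) : ℂ) by push_cast; rfl,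
      Complex.norm_real, Real.norm_of_nonneg (by positivity)]
  rw [besselJ, norm_mul, h2, div_mul_eq_mul_div, one_mul]
  exact div_le_one_of_le₀ h (by positivity)

theorem besselJ_recurrence (m : ℤ) (z : ℂ) :
    z * (besselJ (m - 1) z + besselJ (m + 1) z) = 2 * m * besselJ m z := by
  have hd : ∀ θ ∈ Set.uIcc (0:ℝ) (2 * Real.pi), HasDerivAt
      (fun θ : ℝ => Complex.exp (z * Complex.sin (θ:ℂ) * Complex.I - (m:ℂ) * (θ:ℂ) * Complex.I))
      (Complex.exp (z * Complex.sin (θ:ℂ) * Complex.I - (m:ℂ) * (θ:ℂ) * Complex.I) *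
        (z * Complex.cos (θ:ℂ) * Complex.I - (m:ℂ) * 1 * Complex.I)) θ := fun θ _ =>
    (((((Complex.hasDerivAt_sin (θ:ℂ)).const_mul z).mul_const Complex.I).sub
      (((hasDerivAt_id (θ:ℂ)).const_mul (m:ℂ)).mul_const Complex.I)).cexp).comp_ofReal
  have hi := intervalIntegral.integral_eq_sub_of_hasDerivAt hd
    (Continuous.intervalIntegrable (by fun_prop) _ _)
  have h0 : Complex.exp (z * Complex.sin ((2 * Real.pi : ℝ):ℂ) * Complex.I
      - (m:ℂ) * ((2 * Real.pi : ℝ):ℂ) * Complex.I) = 1 := by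
    rw [← Complex.ofReal_sin, Real.sin_two_pi, Complex.exp_eq_one_iff]
    exact ⟨-m, by push_cast; ring⟩
  rw [h0] at hi
  simp only [Complex.ofReal_zero, Complex.sin_zero, mul_zero, zero_mul,
    Complex.exp_zero, sub_self] at hi
  have hsplit : ∀ θ : ℝ,
      Complex.exp (z * Complex.sin (θ:ℂ) * Complex.I - (m:ℂ) * (θ:ℂ) * Complex.I) *
        (z * Complex.cos (θ:ℂ) * Complex.I - (m:ℂ) * 1 * Complex.I) =
      (Complex.I * z / 2) * (Complex.exp (z * Complex.sin (θ:ℂ) * Complex.I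
          - ((m - 1 : ℤ):ℂ) * (θ:ℂ) * Complex.I)
        + Complex.exp (z * Complex.sin (θ:ℂ) * Complex.I
          - ((m + 1 : ℤ):ℂ) * (θ:ℂ) * Complex.I))
      - (Complex.I * m) *
        Complex.exp (z * Complex.sin (θ:ℂ) * Complex.I - (m:ℂ) * (θ:ℂ) * Complex.I) := by
    intro θ
    have h1 : z * Complex.sin (θ:ℂ) * Complex.I - ((m - 1 : ℤ):ℂ) * (θ:ℂ) * Complex.I =
        (z * Complex.sin (θ:ℂ) * Complex.I - (m:ℂ) * (θ:ℂ) * Complex.I) + θ * Complex.I := by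
      push_cast; ring
    have h2 : z * Complex.sin (θ:ℂ) * Complex.I - ((m + 1 : ℤ):ℂ) * (θ:ℂ) * Complex.I =
        (z * Complex.sin (θ:ℂ) * Complex.I - (m:ℂ) * (θ:ℂ) * Complex.I) + -θ * Complex.I := by
      push_cast; ring
    rw [h1, h2, Complex.exp_add, Complex.exp_add, Complex.cos]
    ring
  have hint : ∀ n : ℤ, IntervalIntegrable (fun θ : ℝ =>
      Complex.exp (z * Complex.sin (θ:ℂ) * Complex.I - (n:ℂ) * (θ:ℂ) * Complex.I))
      MeasureTheory.volume 0 (2 * Real.pi) := fun n =>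
    (continuous_besselJ_integrand n z).intervalIntegrable _ _
  rw [intervalIntegral.integral_congr (fun θ _ => hsplit θ),
    intervalIntegral.integral_sub (((hint _).add (hint _)).const_mul _) ((hint _).const_mul _),
    intervalIntegral.integral_const_mul, intervalIntegral.integral_const_mul,
    intervalIntegral.integral_add (hint _) (hint _)] at hi
  unfold besselJ
  linear_combination (-2 * Complex.I * (1 / (2 * Real.pi))) * hi +
    (1 / (2 * Real.pi)) * (z * ((∫ θ in (0:ℝ)..(2 * Real.pi), Complex.exp (z * Complex.sin (θ:ℂ) *
      Complex.I - ((m - 1 : ℤ):ℂ) * (θ:ℂ) * Complex.I)) + ∫ θ in (0:ℝ)..(2 * Real.pi), Complex.exp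
      (z * Complex.sin (θ:ℂ) * Complex.I - ((m + 1 : ℤ):ℂ) * (θ:ℂ) * Complex.I)) - 2 * m *
      ∫ θ in (0:ℝ)..(2 * Real.pi), Complex.exp (z * Complex.sin (θ:ℂ) * Complex.I - (m:ℂ) * (θ:ℂ) *
      Complex.I)) * Complex.I_sq

theorem besselJ_neg (m : ℤ) (z : ℂ) : besselJ (-m) z = (-1) ^ m * besselJ m z := by
  set f : ℝ → ℂ := fun θ =>
    Complex.exp (z * Complex.sin (θ:ℂ) * Complex.I - (m:ℂ) * (θ:ℂ) * Complex.I) with hf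
  have hper : Function.Periodic f (2 * Real.pi) := by
    intro θ
    simp only [hf]
    rw [Complex.exp_eq_exp_iff_exists_int]
    refine ⟨-m, ?_⟩
    push_cast
    rw [Complex.sin_add_two_pi]
    ring
  have hpi : ((-1 : ℂ) ^ m) = Complex.exp (m * (Real.pi * Complex.I)) := by
    rw [Complex.exp_int_mul, Complex.exp_pi_mul_I]
  have hrefl : ∀ θ : ℝ,
      Complex.exp (z * Complex.sin (θ:ℂ) * Complex.I - ((-m : ℤ):ℂ) * (θ:ℂ) * Complex.I) =
      (-1) ^ m * f (Real.pi - θ) := by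
    intro θ
    simp only [hf]
    rw [hpi, ← Complex.exp_add]
    push_cast
    rw [Complex.sin_pi_sub]
    ring_nf
  unfold besselJ
  rw [intervalIntegral.integral_congr (fun θ _ => hrefl θ), intervalIntegral.integral_const_mul,
    intervalIntegral.integral_comp_sub_left f]
  have := hper.intervalIntegral_add_eq (Real.pi - 2 * Real.pi) 0
  rw [zero_add, show Real.pi - 2 * Real.pi + 2 * Real.pi = Real.pi - 0 by ring] at this
  rw [this]
  ring

theorem abs_mul_norm_besselJ_le {m : ℤ} {z C : ℝ}
    (h₁ : ‖besselJ (m - 1) z‖ ≤ C) (h₂ : ‖besselJ (m + 1) z‖ ≤ C) :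
    |(m : ℝ)| * ‖besselJ m z‖ ≤ |z| * C := by
  have h := congrArg norm (besselJ_recurrence m z)
  rw [norm_mul, norm_mul, norm_mul, Complex.norm_real, Complex.norm_intCast,
    Complex.norm_ofNat, Real.norm_eq_abs] at h
  have h3 : |z| * ‖besselJ (m - 1) z + besselJ (m + 1) z‖ ≤ |z| * (C + C) := by
    gcongr
    exact norm_add_le_of_le h₁ h₂
  linarith

theorem sq_mul_norm_besselJ_le (m : ℤ) (z : ℝ) :
    (m : ℝ) ^ 2 * ‖besselJ m z‖ ≤ |z| * (2 * |z| + 2) := by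
  have key : ∀ n : ℤ, |(m : ℝ)| ≤ |(n : ℝ)| + 1 → |(m : ℝ)| * ‖besselJ n z‖ ≤ |z| + 1 := by
    intro n hn
    have h := abs_mul_norm_besselJ_le (m := n) (norm_besselJ_le_one (n - 1) z)
      (norm_besselJ_le_one (n + 1) z)
    have h1 := norm_besselJ_le_one n z
    have := mul_le_mul_of_nonneg_right hn (norm_nonneg (besselJ n z))
    linarith
  rcases eq_or_ne m 0 with rfl | hm
  · simp only [Int.cast_zero, ne_eq, OfNat.ofNat_ne_zero, not_false_eq_true, zero_pow, zero_mul]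
    positivity
  have hpos : 0 < |(m : ℝ)| := by positivity
  have hrec := abs_mul_norm_besselJ_le (m := m) (z := z) (C := (|z| + 1) / |(m : ℝ)|)
    ((le_div_iff₀' hpos).2 (key _ (by
      push_cast
      have := abs_add_le ((m : ℝ) - 1) 1
      simpa using this)))
    ((le_div_iff₀' hpos).2 (key _ (by
      push_cast
      have := abs_sub ((m : ℝ) + 1) 1
      simpa using this)))
  have := mul_le_mul_of_nonneg_left hrec hpos.le
  rw [← mul_assoc, ← sq, sq_abs] at this
  calc _ ≤ _ := this
    _ = |z| * (|z| + 1) := by field_simp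
    _ ≤ _ := by gcongr <;> linarith [abs_nonneg z]

theorem summable_besselJ (z : ℝ) : Summable fun m : ℤ => besselJ m z := by
  have hs : Summable fun m : ℤ => (|z| * (2 * |z| + 2)) * (1 / (m : ℝ) ^ 2) :=
    (Real.summable_one_div_int_pow.2 one_lt_two).mul_left _
  refine hs.of_norm_bounded_eventually ?_
  rw [Filter.eventually_cofinite]
  refine (Set.finite_singleton (0 : ℤ)).subset fun m hm => ?_
  by_contra h0
  apply hm
  have : (0:ℝ) < (m : ℝ) ^ 2 := by
    have : (m : ℝ) ≠ 0 := by exact_mod_cast h0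
    positivity
  rw [mul_one_div, le_div_iff₀' this]
  exact sq_mul_norm_besselJ_le m z

/-- The Jacobi–Anger expansion. -/
theorem hasSum_besselJ_mul_exp (z θ : ℝ) :
    HasSum (fun m : ℤ => besselJ m z * Complex.exp (m * θ * Complex.I))
      (Complex.exp (z * Real.sin θ * Complex.I)) := by
  have : Fact (0 < 2 * Real.pi) := ⟨Real.two_pi_pos⟩
  let F : C(AddCircle (2 * Real.pi), ℂ) :=
    ⟨fun x => Complex.exp (z * (Real.Angle.sin x : ℝ) * Complex.I), by
      have := Real.Angle.continuous_sin
      exact Complex.continuous_exp.comp ((continuous_const.mul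
        (Complex.continuous_ofReal.comp this)).mul continuous_const)⟩
  have hexp : ∀ (m : ℤ) (x : ℝ), fourier m (x : AddCircle (2 * Real.pi)) =
      Complex.exp (m * x * Complex.I) := by
    intro m x
    rw [fourier_coe_apply]
    congr 1
    have : (Real.pi : ℂ) ≠ 0 := by exact_mod_cast Real.pi_ne_zero
    push_cast
    field_simp
  have hF : ∀ x : ℝ, F (x : AddCircle (2 * Real.pi)) =
      Complex.exp (z * Real.sin x * Complex.I) := fun x => rfl
  have hcoeff : ∀ m : ℤ, fourierCoeff F m = besselJ m z := by
    intro m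
    rw [fourierCoeff_eq_intervalIntegral _ _ 0, zero_add, besselJ, Complex.real_smul]
    congr 1
    · push_cast; rfl
    · refine intervalIntegral.integral_congr fun x _ => ?_
      simp only [smul_eq_mul]
      rw [hexp, hF, ← Complex.exp_add]
      push_cast
      ring_nf
  have hsum : Summable (fourierCoeff F) := by
    simpa only [funext hcoeff] using summable_besselJ z
  have h := has_pointwise_sum_fourier_series_of_summable hsum (θ : AddCircle (2 * Real.pi))
  rw [hF] at h
  simpa only [hcoeff, hexp, smul_eq_mul] using h

theorem hasSum_besselJ_mul_sin (z θ : ℝ) :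
    HasSum (fun n : ℕ => (1 - (-1) ^ n) * besselJ n z * (Real.sin (n * θ) : ℂ))
      (Real.sin (z * Real.sin θ) : ℂ) := by
  have h := ((hasSum_besselJ_mul_exp z θ).sub (hasSum_besselJ_mul_exp z (-θ))).mul_left
    (-Complex.I / 2)
  have hterm : ∀ m : ℤ, -Complex.I / 2 * (besselJ m z * Complex.exp (m * θ * Complex.I) -
      besselJ m z * Complex.exp (m * (-θ : ℝ) * Complex.I)) =
      besselJ m z * Complex.sin (m * θ) := by
    intro m
    rw [Complex.sin]
    push_cast
    ring_nf
  have hval : -Complex.I / 2 * (Complex.exp (z * Real.sin θ * Complex.I) -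
      Complex.exp (z * Real.sin (-θ) * Complex.I)) = Real.sin (z * Real.sin θ) := by
    rw [Real.sin_neg, Complex.ofReal_sin (z * Real.sin θ), Complex.sin]
    push_cast
    ring_nf
  simp only [hterm, hval] at h
  have hnat := h.nat_add_neg
  simp only [besselJ_neg, zpow_natCast, Int.cast_neg, Int.cast_natCast, neg_mul, Complex.sin_neg,
    Int.cast_zero, zero_mul, Complex.sin_zero, mul_zero, add_zero] at hnat
  have hfold : (fun n : ℕ => (1 - (-1) ^ n) * besselJ n z * (Real.sin (n * θ) : ℂ)) = fun n : ℕ =>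
      besselJ n z * Complex.sin (n * θ) + (-1) ^ n * besselJ n z * -Complex.sin (n * θ) := by
    funext n
    push_cast
    ring
  rw [hfold]
  exact hnat

theorem sum_sin_add_two_pi_mul_div_three {n : ℕ} (hn : ¬ 3 ∣ n) (y : ℝ) :
    ∑ ℓ ∈ Finset.range 3, Real.sin (n * (y + 2 * π * ℓ / 3)) = 0 := by
  have hc : Real.cos (2 * π * n / 3) = -(1 / 2) := by
    obtain h | h : n % 3 = 1 ∨ n % 3 = 2 := by omega
    · have hn : (n : ℝ) = 3 * (n / 3 : ℕ) + 1 := by norm_cast; omega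
      rw [hn, show 2 * π * (3 * ((n / 3 : ℕ) : ℝ) + 1) / 3 =
        (π - π / 3) + (n / 3 : ℕ) * (2 * π) by ring, Real.cos_add_nat_mul_two_pi,
        Real.cos_pi_sub, Real.cos_pi_div_three]
    · have hn : (n : ℝ) = 3 * (n / 3 : ℕ) + 2 := by norm_cast; omega
      rw [hn, show 2 * π * (3 * ((n / 3 : ℕ) : ℝ) + 2) / 3 =
        (π / 3 + π) + (n / 3 : ℕ) * (2 * π) by ring, Real.cos_add_nat_mul_two_pi,
        Real.cos_add_pi, Real.cos_pi_div_three]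
  set d := 2 * π * n / 3 with hd
  have h0 : (n : ℝ) * (y + 2 * π * (0 : ℕ) / 3) = (n * y + d) - d := by push_cast; ring
  have h1 : (n : ℝ) * (y + 2 * π * (1 : ℕ) / 3) = n * y + d := by rw [hd]; push_cast; ring
  have h2 : (n : ℝ) * (y + 2 * π * (2 : ℕ) / 3) = (n * y + d) + d := by rw [hd]; push_cast; ring
  rw [Finset.sum_range_succ, Finset.sum_range_succ, Finset.sum_range_one, h0, h1, h2,
    Real.sin_sub, Real.sin_add (n * y + d) d, hc]
  ring

theorem sin_six_mul_add_three (k : ℕ) (α : ℝ) (ℓ : ℕ) :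
    Real.sin ((6 * k + 3) * (α + π / 2 + 2 * π * ℓ / 3)) =
      -((-1) ^ k * Real.cos ((6 * k + 3) * α)) := by
  rw [show (6 * (k : ℝ) + 3) * (α + π / 2 + 2 * π * ℓ / 3) =
    ((((6 * k + 3) * α + π / 2) + π) + k * π) + ((k + (2 * k + 1) * ℓ : ℕ) : ℝ) * (2 * π) by
      push_cast; ring, Real.sin_add_nat_mul_two_pi, Real.sin_add_nat_mul_pi, Real.sin_add_pi,
    Real.sin_add_pi_div_two]
  ring

theorem statement11 (z α : ℝ) :
    (∑' k : ℕ, (-1 : ℂ) ^ k * besselJ (6 * k + 3) z * (Real.cos ((6 * k + 3) * α) : ℂ)) =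
      -(1 / 6 : ℂ) * ∑ ℓ ∈ Finset.range 3, (Real.sin (z * Real.cos (α + 2 * π * ℓ / 3)) : ℂ) := by
  have hsum : HasSum (fun n : ℕ => (1 - (-1) ^ n) * besselJ n z *
      ((∑ ℓ ∈ Finset.range 3, Real.sin (n * (α + π / 2 + 2 * π * ℓ / 3)) : ℝ) : ℂ))
      (∑ ℓ ∈ Finset.range 3, (Real.sin (z * Real.cos (α + 2 * π * ℓ / 3)) : ℂ)) := by
    have h := hasSum_sum (s := Finset.range 3)
      fun ℓ _ => hasSum_besselJ_mul_sin z (α + π / 2 + 2 * π * (ℓ : ℝ) / 3)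
    convert h using 1
    · funext n
      rw [Complex.ofReal_sum, Finset.mul_sum]
    · refine Finset.sum_congr rfl fun ℓ _ => ?_
      rw [show α + π / 2 + 2 * π * (ℓ : ℝ) / 3 = (α + 2 * π * ℓ / 3) + π / 2 by ring,
        Real.sin_add_pi_div_two]
  have hinj : Function.Injective fun k : ℕ => 6 * k + 3 := fun a b h => by
    simpa using h
  rw [← hinj.hasSum_iff] at hsum
  · rw [← (hsum.mul_left (-(1 / 6 : ℂ))).tsum_eq]
    refine tsum_congr fun k => ?_
    have hodd : (-1 : ℂ) ^ (6 * k + 3) = -1 := Odd.neg_one_pow ⟨3 * k + 1, by ring⟩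
    simp only [Function.comp_apply, hodd]
    push_cast [sin_six_mul_add_three]
    simp only [Finset.sum_const, Finset.card_range]
    ring
  · intro n hn
    by_cases h3 : 3 ∣ n
    · have heven : Even n := by
        by_contra ho
        rw [Nat.not_even_iff_odd] at ho
        obtain ⟨a, rfl⟩ := ho
        exact hn ⟨a / 3, by simp only; omega⟩
      simp [heven.neg_one_pow]
    · rw [sum_sin_add_two_pi_mul_div_three h3]
      simp
end

section
/- For all real x and y: Σ_{k=1}^∞ J_{4k}(x)·J_{4k}(y) = (1/8)·[J_0(x+y) + J_0(x−y) − 4·J_0(x)·J_0(y) + 2·J_0(√(x²+y²))]. -/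
open scoped Real

open MeasureTheory ComplexConjugate Function

/-- The `n`-th Fourier coefficient of a `2π`-periodic function on the line. -/
noncomputable def periodicFourierCoeff (f : ℝ → ℂ) (n : ℤ) : ℂ :=
  (1 / (2 * π)) * ∫ θ in (0 : ℝ)..(2 * π), f θ * Complex.exp (-(n * θ * Complex.I))

lemma besselJ_eq_periodicFourierCoeff (m : ℤ) (z : ℂ) :
    besselJ m z =
      periodicFourierCoeff (fun θ : ℝ => Complex.exp (z * Complex.sin θ * Complex.I)) m := by
  simp only [besselJ, periodicFourierCoeff, sub_eq_add_neg, Complex.exp_add]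

lemma Function.Periodic.integral_comp_add_const {f : ℝ → ℂ} {T : ℝ} (hf : Periodic f T) (c : ℝ) :
    ∫ θ in (0 : ℝ)..T, f (θ + c) = ∫ θ in (0 : ℝ)..T, f θ := by
  rw [intervalIntegral.integral_comp_add_right]
  simpa [add_comm] using hf.intervalIntegral_add_eq c 0

lemma Function.Periodic.integral_comp_const_sub {f : ℝ → ℂ} {T : ℝ} (hf : Periodic f T) (c : ℝ) :
    ∫ θ in (0 : ℝ)..T, f (c - θ) = ∫ θ in (0 : ℝ)..T, f θ := by
  rw [intervalIntegral.integral_comp_sub_left]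
  simpa using hf.intervalIntegral_add_eq (c - T) 0

lemma periodic_exp_neg_int_mul (n : ℤ) :
    Periodic (fun θ : ℝ => Complex.exp (-(n * θ * Complex.I))) (2 * π) := by
  intro θ
  rw [Complex.exp_eq_exp_iff_exists_int]
  exact ⟨-n, by push_cast; ring⟩

lemma periodic_exp_mul_sin (z : ℂ) :
    Periodic (fun θ : ℝ => Complex.exp (z * Complex.sin θ * Complex.I)) (2 * π) := by
  intro θ
  simp [Complex.sin_add_two_pi]

/-- Parseval's identity for continuous `2π`-periodic functions on the line. -/
lemma hasSum_conj_periodicFourierCoeff_mul {f g : ℝ → ℂ} (hf : Continuous f) (hg : Continuous g)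
    (hfp : Periodic f (2 * π)) (hgp : Periodic g (2 * π)) :
    HasSum (fun n : ℤ => conj (periodicFourierCoeff f n) * periodicFourierCoeff g n)
      ((1 / (2 * π)) * ∫ θ in (0 : ℝ)..(2 * π), g θ * conj (f θ)) := by
  have : Fact (0 < 2 * π) := ⟨Real.two_pi_pos⟩
  let F : C(AddCircle (2 * π), ℂ) := ⟨hfp.lift, continuous_coinduced_dom.mpr hf⟩
  let G : C(AddCircle (2 * π), ℂ) := ⟨hgp.lift, continuous_coinduced_dom.mpr hg⟩
  have coeff : ∀ (h : ℝ → ℂ) (hp : Periodic h (2 * π)) (n : ℤ),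
      fourierCoeff hp.lift n = periodicFourierCoeff h n := by
    intro h hp n
    rw [fourierCoeff_eq_intervalIntegral _ _ 0, periodicFourierCoeff, zero_add, Complex.real_smul]
    push_cast
    congr 1
    refine intervalIntegral.integral_congr fun θ _ => ?_
    simp only [Periodic.lift_coe, fourier_coe_apply, smul_eq_mul]
    rw [mul_comm]
    congr 2
    have : (π : ℂ) ≠ 0 := by exact_mod_cast Real.pi_ne_zero
    push_cast
    field_simp
  have key := fourierBasis.hasSum_inner_mul_inner
    (ContinuousMap.toLp (E := ℂ) 2 AddCircle.haarAddCircle ℂ F)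
    (ContinuousMap.toLp (E := ℂ) 2 AddCircle.haarAddCircle ℂ G)
  rw [ContinuousMap.inner_toLp, AddCircle.integral_haarAddCircle,
    ← AddCircle.intervalIntegral_preimage (2 * π) 0] at key
  convert! key using 1
  · funext n
    rw [← inner_conj_symm, ← HilbertBasis.repr_apply_apply, ← HilbertBasis.repr_apply_apply,
      fourierBasis_repr, fourierBasis_repr, fourierCoeff_toLp, fourierCoeff_toLp]
    exact congrArg₂ (fun a b => conj a * b) (coeff f hfp n).symm (coeff g hgp n).symm
  · rw [zero_add, Complex.real_smul]
    push_cast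
    rw [one_div]
    rfl

lemma periodicFourierCoeff_comp_add_const {f : ℝ → ℂ} (hf : Periodic f (2 * π)) (φ : ℝ) (n : ℤ) :
    periodicFourierCoeff (fun θ => f (θ + φ)) n =
      Complex.exp (n * φ * Complex.I) * periodicFourierCoeff f n := by
  have hshift := (hf.mul (periodic_exp_neg_int_mul n)).integral_comp_add_const φ
  simp only [Pi.mul_apply] at hshift
  unfold periodicFourierCoeff
  rw [← hshift, mul_left_comm,
    ← intervalIntegral.integral_const_mul (Complex.exp (n * φ * Complex.I))]
  congr 1
  refine intervalIntegral.integral_congr fun θ _ => ?_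
  beta_reduce
  rw [mul_left_comm, ← Complex.exp_add]
  congr 2
  push_cast
  ring

lemma conj_besselJ_ofReal (m : ℤ) (x : ℝ) : conj (besselJ m x) = besselJ m x := by
  have hp := (periodic_exp_mul_sin x).mul (periodic_exp_neg_int_mul m)
  rw [besselJ_eq_periodicFourierCoeff, periodicFourierCoeff, map_mul,
    ← intervalIntegral.intervalIntegral_conj]
  congr 1
  · simp [Complex.conj_ofNat]
  · refine Eq.trans ?_ (hp.integral_comp_const_sub 0)
    refine intervalIntegral.integral_congr fun θ _ => ?_
    simp [← Complex.exp_conj, ← Complex.sin_conj]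

lemma besselJ_neg_four_mul (k : ℤ) (z : ℂ) : besselJ (4 * -k) z = besselJ (4 * k) z := by
  have hp := (periodic_exp_mul_sin z).mul (periodic_exp_neg_int_mul (4 * k))
  simp only [besselJ_eq_periodicFourierCoeff, periodicFourierCoeff]
  congr 1
  refine Eq.trans ?_ (hp.integral_comp_const_sub π)
  refine intervalIntegral.integral_congr fun θ _ => ?_
  simp only [Pi.mul_apply]
  congr 1
  · simp [Complex.sin_pi_sub]
  · rw [Complex.exp_eq_exp_iff_exists_int]
    exact ⟨2 * k, by push_cast; ring⟩

/-- Graf's addition theorem for `J₀`, the third side `R` and angle `α` of the triangle being given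
by their defining relations. -/
lemma hasSum_besselJ_mul_besselJ_mul_exp {x y φ R α : ℝ}
    (hcos : R * Real.cos α = y * Real.cos φ - x) (hsin : R * Real.sin α = y * Real.sin φ) :
    HasSum (fun n : ℤ => besselJ n x * besselJ n y * Complex.exp (n * φ * Complex.I))
      (besselJ 0 R) := by
  have hcont : ∀ z : ℂ, Continuous fun θ : ℝ => Complex.exp (z * Complex.sin θ * Complex.I) :=
    fun z => by fun_prop
  have key := hasSum_conj_periodicFourierCoeff_mul (hcont x)
    ((hcont y).comp (continuous_add_const φ)) (periodic_exp_mul_sin x)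
    (g := fun θ => Complex.exp (y * Complex.sin ((θ + φ : ℝ) : ℂ) * Complex.I))
    (fun θ => by
      have := periodic_exp_mul_sin y (θ + φ)
      rwa [add_right_comm] at this)
  convert! key using 1
  · funext n
    rw [periodicFourierCoeff_comp_add_const (periodic_exp_mul_sin y),
      ← besselJ_eq_periodicFourierCoeff, ← besselJ_eq_periodicFourierCoeff, conj_besselJ_ofReal]
    ring
  · have hshift :=
      ((periodic_exp_mul_sin R).mul (periodic_exp_neg_int_mul 0)).integral_comp_add_const α
    simp only [Pi.mul_apply] at hshift
    rw [besselJ_eq_periodicFourierCoeff, periodicFourierCoeff, ← hshift]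
    congr 1
    refine intervalIntegral.integral_congr fun θ _ => ?_
    have hphase : R * Real.sin (θ + α) = y * Real.sin (θ + φ) - x * Real.sin θ := by
      rw [Real.sin_add, Real.sin_add]
      linear_combination Real.sin θ * hcos + Real.cos θ * hsin
    have hphase' : (R : ℂ) * Complex.sin ((θ + α : ℝ) : ℂ) =
        y * Complex.sin ((θ + φ : ℝ) : ℂ) - x * Complex.sin θ := by
      exact_mod_cast congrArg (Complex.ofReal) hphase
    rw [hphase', ← Complex.exp_conj, ← Complex.exp_add, ← Complex.exp_add]
    congr 1
    simp [← Complex.sin_conj]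
    ring

lemma exists_polar_coord_sqrt (a b : ℝ) :
    ∃ α : ℝ, √(a ^ 2 + b ^ 2) * Real.cos α = a ∧ √(a ^ 2 + b ^ 2) * Real.sin α = b := by
  refine ⟨Complex.arg ⟨a, b⟩, ?_⟩
  have h : ‖(⟨a, b⟩ : ℂ)‖ = √(a ^ 2 + b ^ 2) := by
    rw [Complex.norm_def, Complex.normSq_mk, sq, sq]
  rw [← h]
  exact ⟨Complex.norm_mul_cos_arg _, Complex.norm_mul_sin_arg _⟩

lemma Complex.one_add_neg_one_zpow_add_I_zpow_add_neg_I_zpow (n : ℤ) :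
    1 + (-1) ^ n + I ^ n + (-I) ^ n = if 4 ∣ n then (4 : ℂ) else 0 := by
  obtain ⟨q, r, hr, rfl⟩ : ∃ q : ℤ, ∃ r : ℕ, r < 4 ∧ n = 4 * q + r :=
    ⟨n / 4, (n % 4).toNat, by omega, by omega⟩
  have hI : (I : ℂ) ^ (4 : ℤ) = 1 := by exact_mod_cast I_pow_four
  have hnI : (-I : ℂ) ^ (4 : ℤ) = 1 := by
    rw [Even.neg_zpow (by decide)]; exact hI
  have hn1 : (-1 : ℂ) ^ (4 : ℤ) = 1 := by norm_num
  have hdvd : (4 : ℤ) ∣ 4 * q + r ↔ r = 0 := by omega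
  rw [zpow_add₀ (by simp), zpow_add₀ I_ne_zero, zpow_add₀ (by simp), zpow_mul, zpow_mul, zpow_mul,
    hI, hnI, hn1]
  simp only [one_zpow, one_mul, zpow_natCast, hdvd]
  interval_cases r
  · norm_num
  · norm_num
  · norm_num
  · norm_num [pow_succ]

lemma hasSum_besselJ_four_mul (x y : ℝ) :
    HasSum (fun k : ℤ => besselJ (4 * k) x * besselJ (4 * k) y)
      ((1 / 4 : ℂ) * (besselJ 0 ((x + y : ℝ) : ℂ) + besselJ 0 ((x - y : ℝ) : ℂ) +
        2 * besselJ 0 ((√(x ^ 2 + y ^ 2) : ℝ) : ℂ))) := by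
  obtain ⟨α, hα, hα'⟩ := exists_polar_coord_sqrt (-x) y
  obtain ⟨β, hβ, hβ'⟩ := exists_polar_coord_sqrt (-x) (-y)
  simp only [neg_sq] at hα hα' hβ hβ'
  have h₀ := hasSum_besselJ_mul_besselJ_mul_exp (x := x) (y := y) (φ := 0) (R := x - y) (α := π)
    (by simp) (by simp)
  have hπ := hasSum_besselJ_mul_besselJ_mul_exp (x := x) (y := y) (φ := π) (R := x + y) (α := π)
    (by simp; ring) (by simp)
  have hI := hasSum_besselJ_mul_besselJ_mul_exp (x := x) (y := y) (φ := π / 2) (α := α)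
    (by simpa using hα) (by simpa using hα')
  have hnI := hasSum_besselJ_mul_besselJ_mul_exp (x := x) (y := y) (φ := -(π / 2)) (α := β)
    (by simpa using hβ) (by simpa using hβ')
  have hsum := (((h₀.add hπ).add hI).add hnI).mul_left (1 / 4 : ℂ)
  have hinj : Injective fun k : ℤ => 4 * k := fun a b h => by simpa using h
  have hfun : ∀ n : ℤ, (1 / 4 : ℂ) *
      (besselJ n x * besselJ n y * Complex.exp (n * (0 : ℝ) * Complex.I) +
        besselJ n x * besselJ n y * Complex.exp (n * π * Complex.I) +
        besselJ n x * besselJ n y * Complex.exp (n * (π / 2 : ℝ) * Complex.I) +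
        besselJ n x * besselJ n y * Complex.exp (n * (-(π / 2) : ℝ) * Complex.I)) =
      if 4 ∣ n then besselJ n x * besselJ n y else 0 := by
    intro n
    have e₁ : Complex.exp (n * (π / 2 : ℝ) * Complex.I) = Complex.I ^ n := by
      rw [mul_assoc, Complex.exp_int_mul]
      push_cast
      rw [Complex.exp_pi_div_two_mul_I]
    have e₂ : Complex.exp (n * (-(π / 2) : ℝ) * Complex.I) = (-Complex.I) ^ n := by
      rw [mul_assoc, Complex.exp_int_mul]
      push_cast
      rw [← neg_div, Complex.exp_neg_pi_div_two_mul_I]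
    have e₃ : Complex.exp (n * π * Complex.I) = (-1) ^ n := by
      rw [mul_assoc, Complex.exp_int_mul, Complex.exp_pi_mul_I]
    have hfour := Complex.one_add_neg_one_zpow_add_I_zpow_add_neg_I_zpow n
    rw [e₁, e₂, e₃, Complex.ofReal_zero, mul_zero, zero_mul, Complex.exp_zero]
    split_ifs at hfour ⊢ <;> linear_combination (1 / 4 : ℂ) * besselJ n x * besselJ n y * hfour
  simp only [hfun] at hsum
  rw [← hinj.hasSum_iff (fun n hn => if_neg fun ⟨k, hk⟩ => hn ⟨k, hk.symm⟩)] at hsum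
  convert! hsum using 1
  · funext k
    simp
  · ring

theorem statement19 (x y : ℝ) :
    (∑' k : ℕ, besselJ (4 * (k + 1)) x * besselJ (4 * (k + 1)) y) =
      (1 / 8 : ℂ) * (besselJ 0 ((x + y : ℝ) : ℂ) + besselJ 0 ((x - y : ℝ) : ℂ) -
        4 * besselJ 0 x * besselJ 0 y + 2 * besselJ 0 ((Real.sqrt (x ^ 2 + y ^ 2) : ℝ) : ℂ)) := by
  have h := (hasSum_besselJ_four_mul x y).nat_add_neg
  rw [← hasSum_nat_add_iff' 1] at h
  have h' := h.mul_left (1 / 2 : ℂ)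
  simp only [besselJ_neg_four_mul, Finset.sum_range_one, Nat.cast_zero, mul_zero, Nat.cast_add,
    Nat.cast_one] at h'
  convert h'.tsum_eq using 1
  · refine tsum_congr fun k => ?_
    ring
  · ring
end
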